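/- arXiv:1905.07003 — 2 statements merged into one kernel-verified Lean document; each statement's English description precedes it below -/
import Mathlib

section
/- Let (X,𝓔) be a coarse space with asdim X ≤ k and fix a basepoint x₀ ∈ X. Then for every n ∈ ℕ the subset X^(n) = {x ∈ ∗X : ord(x) = n} of the coarse free product (∗X, ∗𝓔) satisfies asdim X^(n) ≤ k (with the subspace coarse structure). -/
open Set

universe u v

/-- Composition of two relations. -/
def rcomp {X : Type u} (E F : Set (X × X)) : Set (X × X) :=
  {p | ∃ y, (p.1, y) ∈ E ∧ (y, p.2) ∈ F}

/-- A collection of subsets of `X × X` is a coarse structure if it contains the diagonal and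
is closed under inverses, finite unions, subsets and compositions. -/
def IsCoarseStructure {X : Type u} (𝓔 : Set (Set (X × X))) : Prop :=
  {p : X × X | p.1 = p.2} ∈ 𝓔 ∧
    (∀ E ∈ 𝓔, Prod.swap '' E ∈ 𝓔) ∧
    (∀ E ∈ 𝓔, ∀ F ∈ 𝓔, E ∪ F ∈ 𝓔) ∧
    (∀ E ∈ 𝓔, ∀ F, F ⊆ E → F ∈ 𝓔) ∧
    (∀ E ∈ 𝓔, ∀ F ∈ 𝓔, rcomp E F ∈ 𝓔)

/-- `compIter E k` is the `k`-fold composition `E ∘ E ∘ ⋯ ∘ E`, with `E^0 = E ∩ Δ`. -/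
def compIter {X : Type u} (E : Set (X × X)) : ℕ → Set (X × X)
  | 0 => E ∩ {p | p.1 = p.2}
  | 1 => E
  | k + 2 => rcomp E (compIter E (k + 1))

/-- `DE E x y = min {k : (x,y) ∈ E^k}`, with value `∞` if there is no such `k`. -/
noncomputable def DE {X : Type u} (E : Set (X × X)) (x y : X) : ℕ∞ :=
  sInf {n : ℕ∞ | ∃ k : ℕ, n = (k : ℕ∞) ∧ (x, y) ∈ compIter E k}

/-- The free product `∗X`: finite words in the alphabet `X \ {x₀}`. -/
def FreeWord (X : Type u) (x₀ : X) : Type u := {l : List X // x₀ ∉ l}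

/-- Concatenation of words. -/
def FreeWord.concat {X : Type u} {x₀ : X} (x y : FreeWord X x₀) : FreeWord X x₀ :=
  ⟨x.1 ++ y.1, fun h => (List.mem_append.mp h).elim x.2 y.2⟩

/-- The order (length) of a word. -/
def FreeWord.ord {X : Type u} {x₀ : X} (x : FreeWord X x₀) : ℕ := x.1.length

/-- The empty word `ε`. -/
def FreeWord.epsilon (X : Type u) (x₀ : X) : FreeWord X x₀ := ⟨[], by simp⟩

/-- The one-letter word on a letter `u ≠ x₀`. -/
def FreeWord.single {X : Type u} {x₀ : X} (u : X) (h : u ≠ x₀) : FreeWord X x₀ :=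
  ⟨[u], by simp only [List.mem_singleton]; exact fun hh => h hh.symm⟩

/-- `‖x₁⋯x_k‖_E = Σᵢ D_E(x₀, xᵢ)`. -/
noncomputable def wnormL {X : Type u} (E : Set (X × X)) (x₀ : X) (l : List X) : ℕ∞ :=
  (l.map fun a => DE E x₀ a).sum

/-- `‖x₁⋯x_k‖^E = Σᵢ D_E(xᵢ, x₀)`. -/
noncomputable def wnormR {X : Type u} (E : Set (X × X)) (x₀ : X) (l : List X) : ℕ∞ :=
  (l.map fun a => DE E a x₀).sum

open Classical in
/-- `D*_E` on underlying lists: equal words are at distance `0`; otherwise strip the longest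
common prefix `a`, at the first difference `x = a·b·c`, `x' = a·b'·c'` (with `b = x₀` and `c = ε`
when a word has run out) the value is `D_E(b,b') + ‖c‖_E + ‖c'‖^E`. -/
noncomputable def DstarList {X : Type u} (E : Set (X × X)) (x₀ : X) :
    List X → List X → ℕ∞
  | [], [] => 0
  | [], b :: t => DE E x₀ b + wnormR E x₀ t
  | a :: s, [] => DE E a x₀ + wnormL E x₀ s
  | a :: s, b :: t =>
      if a = b then DstarList E x₀ s t
      else DE E a b + wnormL E x₀ s + wnormR E x₀ t

/-- `D*_E` on the free product `∗X`. -/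
noncomputable def Dstar {X : Type u} (E : Set (X × X)) (x₀ : X)
    (x y : FreeWord X x₀) : ℕ∞ :=
  DstarList E x₀ x.1 y.1

/-- `⟨E,n⟩ = {(x,x') : D*_E(x,x') ≤ n}`. -/
def bracket {X : Type u} (E : Set (X × X)) (x₀ : X) (n : ℕ) :
    Set (FreeWord X x₀ × FreeWord X x₀) :=
  {p | Dstar E x₀ p.1 p.2 ≤ (n : ℕ∞)}

/-- The coarse free product structure `∗𝓔`: the subset closure of the sets `⟨E,n⟩`. -/
def freeEnts {X : Type u} (𝓔 : Set (Set (X × X))) (x₀ : X) :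
    Set (Set (FreeWord X x₀ × FreeWord X x₀)) :=
  {L | ∃ E ∈ 𝓔, ∃ n : ℕ, L ⊆ bracket E x₀ n}

/-- A family of subsets is `E`-disjoint if products of distinct members miss `E`. -/
def EDisjointFam {Y : Type v} (𝒰 : Set (Set Y)) (E : Set (Y × Y)) : Prop :=
  ∀ U ∈ 𝒰, ∀ V ∈ 𝒰, U ≠ V → ∀ u ∈ U, ∀ v ∈ V, (u, v) ∉ E

/-- A family of subsets is `K`-bounded if `∪ U × U ⊆ K`. -/
def KBoundedFam {Y : Type v} (𝒰 : Set (Set Y)) (K : Set (Y × Y)) : Prop :=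
  ∀ U ∈ 𝒰, ∀ u ∈ U, ∀ v ∈ U, (u, v) ∈ K

/-- Asymptotic dimension at most `n` of a space with entourage collection `ents`. -/
def AsdimLE {Y : Type v} (ents : Set (Set (Y × Y))) (n : ℕ) : Prop :=
  ∀ E ∈ ents, ∃ K ∈ ents, ∃ 𝒰 : Fin (n + 1) → Set (Set Y),
    (∀ y : Y, ∃ i, ∃ V ∈ 𝒰 i, y ∈ V) ∧
    (∀ i, EDisjointFam (𝒰 i) E) ∧
    (∀ i, KBoundedFam (𝒰 i) K)

/-- The subspace coarse structure on `A ⊆ Y`. -/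
def subEnts {Y : Type v} (ents : Set (Set (Y × Y))) (A : Set Y) :
    Set (Set (↥A × ↥A)) :=
  {L | (Prod.map ((↑) : A → Y) ((↑) : A → Y)) '' L ∈ ents}

/-- Entourages of the total space `T({U_i}; J) = ⊔ᵢ Uᵢ` of a family of subsets. -/
def totalEnts {Y : Type v} {J : Type*} (ents : Set (Set (Y × Y))) (U : J → Set Y) :
    Set (Set ((Σ i : J, ↥(U i)) × (Σ i : J, ↥(U i)))) :=
  {L | ∃ E ∈ ents, ∀ p ∈ L, p.1.1 = p.2.1 ∧ ((p.1.2 : Y), (p.2.2 : Y)) ∈ E}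

/-- A family `{U_i}` has asymptotic dimension at most `m` uniformly if its total space does. -/
def UniformAsdimLE {Y : Type v} {J : Type*} (ents : Set (Set (Y × Y)))
    (U : J → Set Y) (m : ℕ) : Prop :=
  AsdimLE (totalEnts ents U) m

/-- The symmetric ball `B(x₀, E)`. -/
def symmBall {X : Type u} (E : Set (X × X)) (x₀ : X) : Set X :=
  {y | (x₀, y) ∈ E ∨ (y, x₀) ∈ E}

/-- The `M`-cone `con_M(A) = A · (∗B(x₀,M))`. -/
def cone {X : Type u} (M : Set (X × X)) (x₀ : X) (A : Set (FreeWord X x₀)) :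
    Set (FreeWord X x₀) :=
  {z | ∃ a ∈ A, ∃ w : FreeWord X x₀, (∀ c ∈ w.1, c ∈ symmBall M x₀) ∧ z = a.concat w}

/-- Words of equal length related at scale `F`: at the first difference the letters are `F`-related,
and all later letters are `F`-related to the basepoint. -/
def WordRel {X : Type u} (F : Set (X × X)) (x₀ : X) : List X → List X → Prop
  | [], [] => True
  | [], _ :: _ => False
  | _ :: _, [] => False
  | a :: s, b :: t =>
      (a = b ∧ WordRel F x₀ s t) ∨
        (a ≠ b ∧ (a, b) ∈ F ∧ (∀ c ∈ s, (x₀, c) ∈ F) ∧ ∀ c ∈ t, (c, x₀) ∈ F)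

theorem WordRel.refl {X : Type u} (F : Set (X × X)) (x₀ : X) (l : List X) :
    WordRel F x₀ l l := by
  induction l with
  | nil => trivial
  | cons a s ih => exact Or.inl ⟨rfl, ih⟩

theorem WordRel.mono {X : Type u} {F G : Set (X × X)} (h : F ⊆ G) {x₀ : X} :
    ∀ {l l' : List X}, WordRel F x₀ l l' → WordRel G x₀ l l'
  | [], [], _ => trivial
  | [], _ :: _, hr => hr
  | _ :: _, [], hr => hr
  | _ :: _, _ :: _, hr => by
      rcases hr with ⟨rfl, hr⟩ | ⟨hne, hab, hs, ht⟩
      · exact Or.inl ⟨rfl, WordRel.mono h hr⟩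
      · exact Or.inr ⟨hne, h hab, fun c hc => h (hs c hc), fun c hc => h (ht c hc)⟩

/-- Related words ending in `b` and `b'` either have the same prefix and related last letters, or
distinct related prefixes and last letters close to the basepoint. -/
theorem WordRel.of_snoc {X : Type u} {F : Set (X × X)} {x₀ : X} (hF : ∀ a, (a, a) ∈ F)
    {b b' : X} :
    ∀ {l l' : List X}, l.length = l'.length → WordRel F x₀ (l ++ [b]) (l' ++ [b']) →
      (l = l' ∧ (b, b') ∈ F) ∨ (l ≠ l' ∧ WordRel F x₀ l l' ∧ (x₀, b) ∈ F ∧ (b', x₀) ∈ F)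
  | [], [], _, hr => by
      rcases hr with ⟨rfl, _⟩ | ⟨_, hab, _⟩
      · exact Or.inl ⟨rfl, hF _⟩
      · exact Or.inl ⟨rfl, hab⟩
  | [], _ :: _, hl, _ => by simp at hl
  | _ :: _, [], hl, _ => by simp at hl
  | a :: s, a' :: t, hl, hr => by
      rcases hr with ⟨rfl, hr⟩ | ⟨hne, hab, hs, ht⟩
      · rcases WordRel.of_snoc hF (by simpa using hl) hr with ⟨rfl, h⟩ | ⟨hst, h, hb, hb'⟩
        · exact Or.inl ⟨rfl, h⟩
        · exact Or.inr ⟨by simpa using hst, Or.inl ⟨rfl, h⟩, hb, hb'⟩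
      · exact Or.inr ⟨fun h => hne (List.cons.inj h).1,
          Or.inr ⟨hne, hab, fun c hc => hs c (by simp [hc]), fun c hc => ht c (by simp [hc])⟩,
          hs b (by simp), ht b' (by simp)⟩

theorem WordRel.snoc {X : Type u} {F : Set (X × X)} {x₀ b b' : X} (hbb' : (b, b') ∈ F)
    (hb : (x₀, b) ∈ F) (hb' : (b', x₀) ∈ F) :
    ∀ {l l' : List X}, WordRel F x₀ l l' → WordRel F x₀ (l ++ [b]) (l' ++ [b'])
  | [], [], _ => by
      by_cases h : b = b'
      · exact Or.inl ⟨h, trivial⟩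
      · exact Or.inr ⟨h, hbb', by simp, by simp⟩
  | [], _ :: _, hr => hr.elim
  | _ :: _, [], hr => hr.elim
  | a :: s, a' :: t, hr => by
      rcases hr with ⟨rfl, hr⟩ | ⟨hne, hab, hs, ht⟩
      · exact Or.inl ⟨rfl, WordRel.snoc hbb' hb hb' hr⟩
      · refine Or.inr ⟨hne, hab, fun c hc => ?_, fun c hc => ?_⟩
        · rcases List.mem_append.1 hc with hc | hc
          · exact hs c hc
          · rwa [List.mem_singleton.1 hc]
        · rcases List.mem_append.1 hc with hc | hc
          · exact ht c hc
          · rwa [List.mem_singleton.1 hc]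

theorem WordRel.append_left_singleton {X : Type u} {F : Set (X × X)} {x₀ b b' : X}
    (hbb' : (b, b') ∈ F) (l : List X) : WordRel F x₀ (l ++ [b]) (l ++ [b']) := by
  induction l with
  | nil =>
      by_cases h : b = b'
      · exact Or.inl ⟨h, trivial⟩
      · exact Or.inr ⟨h, hbb', by simp, by simp⟩
  | cons a s ih => exact Or.inl ⟨rfl, ih⟩

theorem compIter_mem {X : Type u} {𝓔 : Set (Set (X × X))} (h𝓔 : IsCoarseStructure 𝓔)
    {E : Set (X × X)} (hE : E ∈ 𝓔) : ∀ k, compIter E k ∈ 𝓔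
  | 0 => h𝓔.2.2.2.1 E hE _ inter_subset_left
  | 1 => hE
  | k + 2 => h𝓔.2.2.2.2 E hE _ (compIter_mem h𝓔 hE (k + 1))

theorem exists_mem_compIter_of_DE_le {X : Type u} {E : Set (X × X)} {x y : X} {m : ℕ}
    (h : DE E x y ≤ m) : ∃ j ≤ m, (x, y) ∈ compIter E j := by
  have hlt : DE E x y < ((m + 1 : ℕ) : ℕ∞) :=
    lt_of_le_of_lt h (by exact_mod_cast Nat.lt_succ_self m)
  obtain ⟨_, ⟨j, rfl, hj⟩, hjm⟩ := sInf_lt_iff.1 hlt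
  exact ⟨j, Nat.lt_succ_iff.1 (by exact_mod_cast hjm), hj⟩

theorem DE_le_one {X : Type u} {E : Set (X × X)} {x y : X} (h : (x, y) ∈ E) :
    DE E x y ≤ 1 :=
  sInf_le ⟨1, rfl, h⟩

/-- Every entourage has, for each `m`, a symmetric reflexive entourage containing all pairs at
`D_E`-distance at most `m`. -/
theorem exists_entourage_of_DE_le {X : Type u} {𝓔 : Set (Set (X × X))}
    (h𝓔 : IsCoarseStructure 𝓔) {E : Set (X × X)} (hE : E ∈ 𝓔) (m : ℕ) :
    ∃ F ∈ 𝓔, (∀ a, (a, a) ∈ F) ∧ (∀ a b, (a, b) ∈ F → (b, a) ∈ F) ∧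
      ∀ a b, DE E a b ≤ m → (a, b) ∈ F := by
  obtain ⟨G, hG, hEG⟩ : ∃ G ∈ 𝓔, ∀ j ≤ m, compIter E j ⊆ G := by
    induction m with
    | zero => exact ⟨_, compIter_mem h𝓔 hE 0, fun j hj => by rw [Nat.le_zero.1 hj]⟩
    | succ m ih =>
        obtain ⟨G, hG, h⟩ := ih
        refine ⟨G ∪ compIter E (m + 1), h𝓔.2.2.1 _ hG _ (compIter_mem h𝓔 hE _), fun j hj => ?_⟩
        rcases Nat.le_succ_iff.1 hj with hj | rfl
        · exact (h j hj).trans subset_union_left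
        · exact subset_union_right
  refine ⟨{p | p.1 = p.2} ∪ (G ∪ Prod.swap '' G),
    h𝓔.2.2.1 _ h𝓔.1 _ (h𝓔.2.2.1 _ hG _ (h𝓔.2.1 _ hG)), fun a => Or.inl rfl, ?_, ?_⟩
  · rintro a b (h | h | ⟨⟨c, d⟩, h, hcd⟩)
    · exact Or.inl (Eq.symm h)
    · exact Or.inr (Or.inr ⟨(a, b), h, rfl⟩)
    · obtain ⟨rfl, rfl⟩ := Prod.mk.inj hcd
      exact Or.inr (Or.inl h)
  · intro a b h
    obtain ⟨j, hj, hab⟩ := exists_mem_compIter_of_DE_le h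
    exact Or.inr (Or.inl (hEG j hj hab))

theorem wordRel_of_DstarList_le {X : Type u} {E F : Set (X × X)} {x₀ : X} {m : ℕ}
    (hF : ∀ a b, DE E a b ≤ m → (a, b) ∈ F) :
    ∀ {l l' : List X}, l.length = l'.length → DstarList E x₀ l l' ≤ m → WordRel F x₀ l l'
  | [], [], _, _ => trivial
  | [], _ :: _, hl, _ => by simp at hl
  | _ :: _, [], hl, _ => by simp at hl
  | a :: s, b :: t, hl, h => by
      by_cases hab : a = b
      · rw [DstarList, if_pos hab] at h
        exact Or.inl ⟨hab, wordRel_of_DstarList_le hF (by simpa using hl) h⟩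
      · rw [DstarList, if_neg hab] at h
        have hs : wnormL E x₀ s ≤ m := (le_add_self.trans le_self_add).trans h
        have ht : wnormR E x₀ t ≤ m := le_add_self.trans h
        refine Or.inr ⟨hab, hF a b ((le_self_add.trans le_self_add).trans h),
          fun c hc => hF _ _ (le_trans ?_ hs), fun c hc => hF _ _ (le_trans ?_ ht)⟩
        · exact List.le_sum_of_mem (List.mem_map_of_mem hc)
        · exact List.le_sum_of_mem (List.mem_map_of_mem hc)

theorem DstarList_le_of_wordRel {X : Type u} {F : Set (X × X)} {x₀ : X} :
    ∀ {l l' : List X}, WordRel F x₀ l l' →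
      DstarList F x₀ l l' ≤ ((l.length + l'.length : ℕ) : ℕ∞)
  | [], [], _ => by simp [DstarList]
  | [], _ :: _, hr => hr.elim
  | _ :: _, [], hr => hr.elim
  | a :: s, b :: t, hr => by
      rcases hr with ⟨rfl, hr⟩ | ⟨hne, hab, hs, ht⟩
      · rw [DstarList, if_pos rfl]
        refine (DstarList_le_of_wordRel hr).trans ?_
        simp only [List.length_cons]
        exact_mod_cast (by omega)
      · rw [DstarList, if_neg hne]
        have h1 : wnormL F x₀ s ≤ (s.length : ℕ∞) := by
          have := List.sum_le_card_nsmul (s.map fun c => DE F x₀ c) 1 (by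
            simpa using fun c hc => DE_le_one (hs c hc))
          simpa [wnormL] using this
        have h2 : wnormR F x₀ t ≤ (t.length : ℕ∞) := by
          have := List.sum_le_card_nsmul (t.map fun c => DE F c x₀) 1 (by
            simpa using fun c hc => DE_le_one (ht c hc))
          simpa [wnormR] using this
        refine (add_le_add (add_le_add (DE_le_one hab) h1) h2).trans ?_
        simp only [List.length_cons]
        exact_mod_cast (by omega)

/-- Words of a fixed length admit, at each scale, a cover by `k + 1` disjoint uniformly bounded
families when the alphabet does. -/
theorem exists_word_cover {X : Type u} {𝓔 : Set (Set (X × X))} (h𝓔 : IsCoarseStructure 𝓔)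
    (x₀ : X) {k : ℕ} (hX : AsdimLE 𝓔 k) {F : Set (X × X)} (hF : F ∈ 𝓔)
    (hrefl : ∀ a, (a, a) ∈ F) (hsymm : ∀ a b, (a, b) ∈ F → (b, a) ∈ F) (n : ℕ) :
    ∃ G ∈ 𝓔, ∃ 𝒱 : Fin (k + 1) → Set (Set (List X)),
      (∀ i, ∀ V ∈ 𝒱 i, ∀ l ∈ V, l.length = n) ∧
      (∀ l : List X, l.length = n → ∃ i, ∃ V ∈ 𝒱 i, l ∈ V) ∧
      (∀ i, EDisjointFam (𝒱 i) {p | WordRel F x₀ p.1 p.2}) ∧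
      (∀ i, KBoundedFam (𝒱 i) {p | WordRel G x₀ p.1 p.2}) := by
  induction n with
  | zero =>
      refine ⟨F, hF, fun _ => {{[]}}, ?_, ?_, ?_, ?_⟩
      · rintro i V rfl l rfl
        rfl
      · intro l hl
        exact ⟨0, _, rfl, List.length_eq_zero_iff.1 hl⟩
      · rintro i U rfl V rfl h
        exact absurd rfl h
      · rintro i U rfl u rfl v rfl
        trivial
  | succ n ih =>
      obtain ⟨L, hL, 𝒱, hlen, hcov, hdisj, hbdd⟩ := ih
      obtain ⟨K, hK, 𝒰, hcovX, hdisjX, hbddX⟩ := hX F hF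
      set M : Set (X × X) := F ∪ rcomp F (rcomp F K)
      have hM𝓔 : M ∈ 𝓔 := h𝓔.2.2.1 _ hF _ (h𝓔.2.2.2.2 _ hF _ (h𝓔.2.2.2.2 _ hF _ hK))
      have hM' := h𝓔.2.1 _ hM𝓔
      let near : Set X → Prop := fun U => ∃ c, (x₀, c) ∈ F ∧ ∃ u ∈ U, (c, u) ∈ F
      let hat : Fin (k + 1) → Set (List X) → Set (List X) := fun i V =>
        {w | ∃ l ∈ V, ∃ b, w = l ++ [b] ∧ ((x₀, b) ∈ F ∨ ∃ U ∈ 𝒰 i, b ∈ U ∧ near U)}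
      let slice : List X → Set X → Set (List X) := fun l U =>
        {w | ∃ b ∈ U, (x₀, b) ∉ F ∧ w = l ++ [b]}
      have hball : ∀ i b, ((x₀, b) ∈ F ∨ ∃ U ∈ 𝒰 i, b ∈ U ∧ near U) → (x₀, b) ∈ M := by
        rintro i b (h | ⟨U, hU, hb, c, hc, u, hu, hcu⟩)
        · exact Or.inl h
        · exact Or.inr ⟨c, hc, u, hcu, hbddX i U hU u hu b hb⟩
      have hsnoc : ∀ {l l' : List X} {b b' : X}, l.length = n → l'.length = n →
          WordRel F x₀ (l ++ [b]) (l' ++ [b']) →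
          (l = l' ∧ (b, b') ∈ F) ∨
            (l ≠ l' ∧ WordRel F x₀ l l' ∧ (x₀, b) ∈ F ∧ (b', x₀) ∈ F) :=
        fun hl hl' h => WordRel.of_snoc hrefl (hl.trans hl'.symm) h
      refine ⟨(L ∪ K) ∪ ((M ∪ Prod.swap '' M) ∪ rcomp (Prod.swap '' M) M),
        h𝓔.2.2.1 _ (h𝓔.2.2.1 _ hL _ hK) _
          (h𝓔.2.2.1 _ (h𝓔.2.2.1 _ hM𝓔 _ hM') _ (h𝓔.2.2.2.2 _ hM' _ hM𝓔)),
        fun i => {W | (∃ V ∈ 𝒱 i, W = hat i V) ∨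
          ∃ l, l.length = n ∧ ∃ U ∈ 𝒰 i, (near U → ∀ V ∈ 𝒱 i, l ∉ V) ∧ W = slice l U},
        ?_, ?_, ?_, ?_⟩
      · rintro i W (⟨V, hV, rfl⟩ | ⟨l, hl, U, hU, -, rfl⟩) w hw
        · obtain ⟨l, hlV, b, rfl, -⟩ := hw
          simp [hlen i V hV l hlV]
        · obtain ⟨b, -, -, rfl⟩ := hw
          simp [hl]
      · intro w hw
        obtain ⟨l, b, rfl⟩ : ∃ l b, w = l ++ [b] := by
          rcases List.eq_nil_or_concat' w with rfl | h
          · simp at hw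
          · exact h
        have hl : l.length = n := by simpa using hw
        by_cases hb : (x₀, b) ∈ F
        · obtain ⟨i, V, hV, hlV⟩ := hcov l hl
          exact ⟨i, _, Or.inl ⟨V, hV, rfl⟩, l, hlV, b, rfl, Or.inl hb⟩
        · obtain ⟨i, U, hU, hbU⟩ := hcovX b
          by_cases hn : near U → ∀ V ∈ 𝒱 i, l ∉ V
          · exact ⟨i, _, Or.inr ⟨l, hl, U, hU, hn, rfl⟩, b, hbU, hb, rfl⟩
          · push Not at hn
            obtain ⟨hnear, V, hV, hlV⟩ := hn
            exact ⟨i, _, Or.inl ⟨V, hV, rfl⟩, l, hlV, b, rfl, Or.inr ⟨U, hU, hbU, hnear⟩⟩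
      · have hmixed : ∀ i, ∀ V ∈ 𝒱 i, ∀ l ∈ V, ∀ l', l'.length = n → ∀ U ∈ 𝒰 i,
            (near U → ∀ V ∈ 𝒱 i, l' ∉ V) → ∀ b,
            ((x₀, b) ∈ F ∨ ∃ U ∈ 𝒰 i, b ∈ U ∧ near U) → ∀ b' ∈ U, (x₀, b') ∉ F →
            l = l' → (b, b') ∈ F → False := by
          rintro i V hV l hlV l' hl' U hU hn b hb b' hb'U hb' rfl hbb'
          have hfar : ¬ near U := fun h => hn h V hV hlV
          rcases hb with hb | ⟨U', hU', hbU', hnear⟩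
          · exact hfar ⟨b, hb, b', hb'U, hbb'⟩
          · refine hdisjX i U' hU' U hU ?_ b hbU' b' hb'U hbb'
            rintro rfl
            exact hfar hnear
        rintro i W (⟨V, hV, rfl⟩ | ⟨l, hl, U, hU, hn, rfl⟩)
          W' (⟨V', hV', rfl⟩ | ⟨l', hl', U', hU', hn', rfl⟩) hne w hw w' hw' hr
        · obtain ⟨l, hlV, b, rfl, hb⟩ := hw
          obtain ⟨l', hlV', b', rfl, hb'⟩ := hw'
          have hVV' : V ≠ V' := fun h => hne (by rw [h])
          refine hdisj i V hV V' hV' hVV' l hlV l' hlV' ?_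
          rcases hsnoc (hlen i V hV l hlV) (hlen i V' hV' l' hlV') hr with ⟨rfl, -⟩ | ⟨-, h, -⟩
          · exact WordRel.refl F x₀ l
          · exact h
        · obtain ⟨l, hlV, b, rfl, hb⟩ := hw
          obtain ⟨b', hb'U, hb', rfl⟩ := hw'
          rcases hsnoc (hlen i V hV l hlV) hl' hr with ⟨h, hbb'⟩ | ⟨-, -, -, h⟩
          · exact hmixed i V hV l hlV l' hl' U' hU' hn' b hb b' hb'U hb' h hbb'
          · exact hb' (hsymm _ _ h)
        · obtain ⟨b, hbU, hb, rfl⟩ := hw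
          obtain ⟨l', hlV', b', rfl, hb'⟩ := hw'
          rcases hsnoc hl (hlen i V' hV' l' hlV') hr with ⟨h, hbb'⟩ | ⟨-, -, h, -⟩
          · exact hmixed i V' hV' l' hlV' l hl U hU hn b' hb' b hbU hb h.symm (hsymm _ _ hbb')
          · exact hb h
        · obtain ⟨b, hbU, hb, rfl⟩ := hw
          obtain ⟨b', hbU', hb', rfl⟩ := hw'
          rcases hsnoc hl hl' hr with ⟨rfl, hbb'⟩ | ⟨-, -, h, -⟩
          · exact hdisjX i U hU U' hU' (fun h => hne (by rw [h])) b hbU b' hbU' hbb'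
          · exact hb h
      · rintro i W (⟨V, hV, rfl⟩ | ⟨l, hl, U, hU, -, rfl⟩) w hw w' hw'
        · obtain ⟨l, hlV, b, rfl, hb⟩ := hw
          obtain ⟨l', hlV', b', rfl, hb'⟩ := hw'
          have hb := hball i b hb
          have hb' := hball i b' hb'
          refine WordRel.snoc (Or.inr (Or.inr ⟨x₀, ⟨(x₀, b), hb, rfl⟩, hb'⟩))
            (Or.inr (Or.inl (Or.inl hb))) (Or.inr (Or.inl (Or.inr ⟨(x₀, b'), hb', rfl⟩))) ?_
          exact WordRel.mono (subset_union_left.trans subset_union_left)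
            (hbdd i V hV l hlV l' hlV')
        · obtain ⟨b, hbU, -, rfl⟩ := hw
          obtain ⟨b', hbU', -, rfl⟩ := hw'
          exact WordRel.append_left_singleton
            (Or.inl (Or.inr (hbddX i U hU b hbU b' hbU'))) l

/-- If `asdim X ≤ k`, then for each `n` the subset `X⁽ⁿ⁾` of words of order `n` in the
coarse free product, with the subspace coarse structure, has `asdim ≤ k`. -/
theorem asdim_orderN_words_le
    {X : Type u} (𝓔 : Set (Set (X × X))) (h𝓔 : IsCoarseStructure 𝓔) (x₀ : X)
    (k : ℕ) (hX : AsdimLE 𝓔 k) (n : ℕ) :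
    AsdimLE (subEnts (freeEnts 𝓔 x₀) {w : FreeWord X x₀ | w.ord = n}) k := by
  rintro E ⟨E₀, hE₀, m, hm⟩
  obtain ⟨F, hF, hrefl, hsymm, hDE⟩ := exists_entourage_of_DE_le h𝓔 hE₀ m
  obtain ⟨G, hG, 𝒱, -, hcov, hdisj, hbdd⟩ := exists_word_cover h𝓔 x₀ hX hF hrefl hsymm n
  let val : {w : FreeWord X x₀ | w.ord = n} → List X := fun w => w.1.1
  have hval : ∀ w, (val w).length = n := fun w => w.2
  refine ⟨{p | WordRel G x₀ (val p.1) (val p.2)}, ⟨G, hG, n + n, ?_⟩,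
    fun i => (val ⁻¹' ·) '' 𝒱 i, ?_, ?_, ?_⟩
  · rintro _ ⟨⟨u, v⟩, h, rfl⟩
    have h' := DstarList_le_of_wordRel h
    rwa [hval, hval] at h'
  · intro w
    obtain ⟨i, V, hV, hw⟩ := hcov (val w) (hval w)
    exact ⟨i, _, ⟨V, hV, rfl⟩, hw⟩
  · rintro i _ ⟨U, hU, rfl⟩ _ ⟨V, hV, rfl⟩ hne u hu v hv huv
    refine hdisj i U hU V hV (fun h => hne (by rw [h])) _ hu _ hv ?_
    exact wordRel_of_DstarList_le hDE ((hval u).trans (hval v).symm) (hm ⟨(u, v), huv, rfl⟩)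
  · rintro i _ ⟨U, hU, rfl⟩ u hu v hv
    exact hbdd i U hU _ hu _ hv
end

section
/- Let (X,𝓔) be a coarse space with basepoint x₀ and let {A_α}_{α∈J} be a collection of flat subsets of ∗X that is uniformly bounded, i.e. there is an entourage of ∗𝓔 containing ∪_α (A_α × A_α). Then for each entourage L ∈ 𝓔, the collection of cones {con_L(A_α)}_{α∈J} has asymptotic dimension bounded by 1 uniformly. -/
open Set

universe u v

open Classical in
/-- The word consisting of the single letter `b` (the empty word when `b = x₀`). -/
noncomputable def FreeWord.ofLetter {X : Type u} (x₀ : X) (b : X) : FreeWord X x₀ :=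
  if h : b = x₀ then ⟨[], by simp⟩
  else ⟨[b], by simp only [List.mem_singleton]; exact fun hh => h hh.symm⟩

/-- A subset of `∗X` is flat if it is contained in `x·X` for some word `x`. -/
def IsFlat {X : Type u} {x₀ : X} (A : Set (FreeWord X x₀)) : Prop :=
  ∃ x : FreeWord X x₀, ∀ z ∈ A, ∃ b : X, z = x.concat (FreeWord.ofLetter x₀ b)

section Distances

variable {X : Type u} {E : Set (X × X)} {x₀ : X}

lemma one_le_DE {a b : X} (h : a ≠ b) : 1 ≤ DE E a b := by
  refine le_sInf ?_
  rintro n ⟨k, rfl, hk⟩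
  cases k with
  | zero => exact absurd hk.2 h
  | succ k => exact_mod_cast Nat.succ_le_succ (Nat.zero_le k)

lemma DE_le_one_s8 {a b : X} (h : (a, b) ∈ E) : DE E a b ≤ 1 :=
  sInf_le ⟨1, by simp, h⟩

lemma exists_compIter_of_DE_le {a b : X} {n : ℕ} (h : DE E a b ≤ n) :
    ∃ k ≤ n, (a, b) ∈ compIter E k := by
  rcases Set.eq_empty_or_nonempty
    {n : ℕ∞ | ∃ k : ℕ, n = (k : ℕ∞) ∧ (a, b) ∈ compIter E k} with h0 | h0
  · rw [DE, h0, sInf_empty] at h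
    simp at h
  · obtain ⟨k, hk, hab⟩ := csInf_mem h0
    refine ⟨k, ?_, hab⟩
    rw [DE, hk] at h
    exact_mod_cast h

lemma length_le_sum_map {f : X → ℕ∞} {l : List X} (h : ∀ c ∈ l, 1 ≤ f c) :
    (l.length : ℕ∞) ≤ (l.map f).sum := by
  induction l with
  | nil => simp
  | cons a l ih =>
    simp only [List.mem_cons, forall_eq_or_imp] at h
    simp only [List.length_cons, List.map_cons, List.sum_cons]
    push_cast
    rw [add_comm]
    exact add_le_add h.1 (ih h.2)

lemma sum_map_le_length {f : X → ℕ∞} {l : List X} (h : ∀ c ∈ l, f c ≤ 1) :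
    (l.map f).sum ≤ l.length := by
  induction l with
  | nil => simp
  | cons a l ih =>
    simp only [List.mem_cons, forall_eq_or_imp] at h
    simp only [List.length_cons, List.map_cons, List.sum_cons]
    push_cast
    rw [add_comm]
    exact add_le_add (ih h.2) h.1

lemma length_le_wnormL {l : List X} (h : x₀ ∉ l) : (l.length : ℕ∞) ≤ wnormL E x₀ l :=
  length_le_sum_map fun _ hc => one_le_DE fun h' => h (h' ▸ hc)

lemma length_le_wnormR {l : List X} (h : x₀ ∉ l) : (l.length : ℕ∞) ≤ wnormR E x₀ l :=
  length_le_sum_map fun _ hc => one_le_DE fun h' => h (h' ▸ hc)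

lemma DstarList_append (p s t : List X) :
    DstarList E x₀ (p ++ s) (p ++ t) = DstarList E x₀ s t := by
  induction p with
  | nil => rfl
  | cons a p ih => simp [DstarList, ih]

/-- Words at `D*`-distance at most `n` have nearly the same length and agree except on their
last `n` letters. -/
lemma length_and_take_of_DstarList_le {n : ℕ} (s t : List X) (hs : x₀ ∉ s) (ht : x₀ ∉ t)
    (h : DstarList E x₀ s t ≤ n) :
    s.length ≤ t.length + n ∧ t.length ≤ s.length + n ∧
      s.take (s.length - n) = t.take (s.length - n) := by
  induction s generalizing t with
  | nil =>
    cases t with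
    | nil => simp
    | cons b t =>
      simp only [List.mem_cons, not_or] at ht
      have h1 := (add_le_add (one_le_DE (E := E) ht.1) (length_le_wnormR ht.2)).trans h
      have h2 : 1 + t.length ≤ n := by exact_mod_cast h1
      simp only [List.length_cons, List.length_nil]
      refine ⟨by omega, by omega, by simp⟩
  | cons a s ih =>
    simp only [List.mem_cons, not_or] at hs
    cases t with
    | nil =>
      have h1 := (add_le_add (one_le_DE (E := E) (Ne.symm hs.1))
        (length_le_wnormL hs.2)).trans h
      have h2 : 1 + s.length ≤ n := by exact_mod_cast h1
      simp only [List.length_cons, List.length_nil]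
      refine ⟨by omega, by omega, ?_⟩
      rw [show s.length + 1 - n = 0 by omega]
      simp
    | cons b t =>
      simp only [List.mem_cons, not_or] at ht
      rw [DstarList] at h
      split_ifs at h with hab
      · subst hab
        obtain ⟨h1, h2, h3⟩ := ih t hs.2 ht.2 h
        simp only [List.length_cons]
        refine ⟨by omega, by omega, ?_⟩
        by_cases hn : n ≤ s.length
        · rw [show s.length + 1 - n = (s.length - n) + 1 by omega]
          simp [h3]
        · rw [show s.length + 1 - n = 0 by omega]
          simp
      · have h1 := (add_le_add (add_le_add (one_le_DE (E := E) hab) (length_le_wnormL hs.2))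
          (length_le_wnormR ht.2)).trans h
        have h2 : 1 + s.length + t.length ≤ n := by exact_mod_cast h1
        simp only [List.length_cons]
        refine ⟨by omega, by omega, ?_⟩
        rw [show s.length + 1 - n = 0 by omega]
        simp

lemma DstarList_le_length {C : Set X} (hC : ∀ a ∈ C, ∀ b ∈ C, (a, b) ∈ E) (hx₀ : x₀ ∈ C)
    (s t : List X) (hs : ∀ c ∈ s.tail, c ∈ C) (ht : ∀ c ∈ t.tail, c ∈ C)
    (hst : (s.headD x₀, t.headD x₀) ∈ E) :
    DstarList E x₀ s t ≤ (s.length + t.length : ℕ) := by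
  have hL : ∀ l : List X, (∀ c ∈ l, c ∈ C) → wnormL E x₀ l ≤ l.length := fun l hl =>
    sum_map_le_length fun c hc => DE_le_one_s8 (hC _ hx₀ _ (hl c hc))
  have hR : ∀ l : List X, (∀ c ∈ l, c ∈ C) → wnormR E x₀ l ≤ l.length := fun l hl =>
    sum_map_le_length fun c hc => DE_le_one_s8 (hC _ (hl c hc) _ hx₀)
  have hhead : ∀ l : List X, (∀ c ∈ l, c ∈ C) → l.headD x₀ ∈ C := by
    rintro (_ | ⟨a, l⟩) hl
    · exact hx₀
    · exact hl a (by simp)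
  induction s generalizing t with
  | nil =>
    cases t with
    | nil => simp [DstarList]
    | cons b t =>
      refine (add_le_add (DE_le_one_s8 hst) (hR t ht)).trans ?_
      norm_cast
      simp only [List.length_cons, List.length_nil]
      omega
  | cons a s ih =>
    cases t with
    | nil =>
      refine (add_le_add (DE_le_one_s8 hst) (hL s hs)).trans ?_
      norm_cast
      simp only [List.length_cons, List.length_nil]
      omega
    | cons b t =>
      rw [DstarList]
      split_ifs with hab
      · refine (ih t (fun c hc => hs c (List.mem_of_mem_tail hc))
          (fun c hc => ht c (List.mem_of_mem_tail hc))
          (hC _ (hhead s hs) _ (hhead t ht))).trans ?_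
        norm_cast
        simp only [List.length_cons]
        omega
      · refine (add_le_add (add_le_add (DE_le_one_s8 hst) (hL s hs)) (hR t ht)).trans ?_
        norm_cast
        simp only [List.length_cons]
        omega

lemma DstarList_le_length_sub {C : Set X} (hC : ∀ a ∈ C, ∀ b ∈ C, (a, b) ∈ E) (hx₀ : x₀ ∈ C)
    (m : ℕ) (s t : List X) (hs : ∀ c ∈ s.tail, c ∈ C) (ht : ∀ c ∈ t.tail, c ∈ C)
    (hst : (s.headD x₀, t.headD x₀) ∈ E) (hm : s.take m = t.take m) :
    DstarList E x₀ s t ≤ ((s.length - m) + (t.length - m) : ℕ) := by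
  have hhead : ∀ l : List X, (∀ c ∈ l, c ∈ C) → l.headD x₀ ∈ C := by
    rintro (_ | ⟨a, l⟩) hl
    · exact hx₀
    · exact hl a (by simp)
  induction m generalizing s t with
  | zero => exact DstarList_le_length hC hx₀ s t hs ht hst
  | succ m ih =>
    cases s with
    | nil =>
      cases t with
      | nil => simp [DstarList]
      | cons b t => simp at hm
    | cons a s =>
      cases t with
      | nil => simp at hm
      | cons b t =>
        simp only [List.take_succ_cons, List.cons.injEq] at hm
        rw [DstarList, if_pos hm.1]
        simpa using ih s t (fun c hc => hs c (List.mem_of_mem_tail hc))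
          (fun c hc => ht c (List.mem_of_mem_tail hc)) (hC _ (hhead s hs) _ (hhead t ht)) hm.2

end Distances

namespace IsCoarseStructure

variable {X : Type u} {𝓔 : Set (Set (X × X))}

lemma compIter_mem (h : IsCoarseStructure 𝓔) {E : Set (X × X)} (hE : E ∈ 𝓔) :
    ∀ k, compIter E k ∈ 𝓔
  | 0 => h.2.2.2.1 E hE _ inter_subset_left
  | 1 => hE
  | k + 2 => h.2.2.2.2 E hE _ (compIter_mem h hE (k + 1))

lemma DE_le_mem (h : IsCoarseStructure 𝓔) {E : Set (X × X)} (hE : E ∈ 𝓔) (n : ℕ) :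
    {p : X × X | DE E p.1 p.2 ≤ n} ∈ 𝓔 := by
  have key : ∀ n : ℕ, {p : X × X | ∃ k ≤ n, p ∈ compIter E k} ∈ 𝓔 := by
    intro n
    induction n with
    | zero =>
      refine h.2.2.2.1 _ (h.compIter_mem hE 0) _ ?_
      rintro p ⟨k, hk, hp⟩
      rwa [Nat.le_zero.mp hk] at hp
    | succ n ih =>
      refine h.2.2.2.1 _ (h.2.2.1 _ ih _ (h.compIter_mem hE (n + 1))) _ ?_
      rintro p ⟨k, hk, hp⟩
      rcases Nat.le_succ_iff.mp hk with hk | rfl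
      · exact Or.inl ⟨k, hk, hp⟩
      · exact Or.inr hp
  exact h.2.2.2.1 _ (key n) _ fun p hp => exists_compIter_of_DE_le hp

end IsCoarseStructure

section Cones

variable {X : Type u} {x₀ : X}

/-- Two letters of a flat set over the same word are as close as the words they complete. -/
lemma DE_le_of_Dstar_ofLetter {E : Set (X × X)} {n : ℕ} {x : FreeWord X x₀} {b b' : X}
    (h : Dstar E x₀ (x.concat (FreeWord.ofLetter x₀ b)) (x.concat (FreeWord.ofLetter x₀ b'))
      ≤ n) :
    b = b' ∨ DE E b b' ≤ n := by
  by_cases hbb : b = b'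
  · exact Or.inl hbb
  right
  rw [Dstar, FreeWord.concat, FreeWord.concat, DstarList_append] at h
  by_cases hb : b = x₀ <;> by_cases hb' : b' = x₀
  · exact absurd (hb.trans hb'.symm) hbb
  all_goals
    simpa [FreeWord.ofLetter, hb, hb', hbb, DstarList, wnormL, wnormR] using h

/-- A point of the cone over a flat set `A ⊆ x·X` is `x` followed by a word whose first letter is
close to a letter of `A` and whose other letters lie in the ball. -/
lemma exists_suffix_of_mem_cone {L : Set (X × X)} {A : Set (FreeWord X x₀)} {x : FreeWord X x₀}
    (hA : ∀ z ∈ A, ∃ b : X, z = x.concat (FreeWord.ofLetter x₀ b)) {z : FreeWord X x₀}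
    (hz : z ∈ cone L x₀ A) :
    ∃ l : List X, z.1 = x.1 ++ l ∧ (∀ c ∈ l.tail, c ∈ symmBall L x₀) ∧
      ∃ b, x.concat (FreeWord.ofLetter x₀ b) ∈ A ∧
        (l.headD x₀ = b ∨ b = x₀ ∧ l.headD x₀ ∈ symmBall L x₀) := by
  obtain ⟨a, ha, w, hw, rfl⟩ := hz
  obtain ⟨b, rfl⟩ := hA a ha
  by_cases hb : b = x₀
  · refine ⟨w.1, by simp [FreeWord.concat, FreeWord.ofLetter, hb],
      fun c hc => hw c (List.mem_of_mem_tail hc), b, ha, ?_⟩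
    rcases hwl : w.1 with _ | ⟨c, l⟩
    · exact Or.inl hb.symm
    · exact Or.inr ⟨hb, hw c (by simp [hwl])⟩
  · exact ⟨b :: w.1, by simp [FreeWord.concat, FreeWord.ofLetter, hb], hw, b, ha, Or.inl rfl⟩

end Cones

/-- Cones over uniformly bounded flat sets are uniformly controlled: there is one entourage `F` for
which two points agreeing on their first `m` letters are at `D*_F`-distance at most the number of
their remaining letters. -/
lemma exists_entourage_cone_Dstar_le {X : Type u} {𝓔 : Set (Set (X × X))}
    (h𝓔 : IsCoarseStructure 𝓔) {x₀ : X} {J : Type v} {A : J → Set (FreeWord X x₀)}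
    (hflat : ∀ α : J, IsFlat (A α))
    (hbdd : ∃ Kb ∈ freeEnts 𝓔 x₀, ∀ α : J, ∀ u ∈ A α, ∀ v ∈ A α, (u, v) ∈ Kb)
    {L : Set (X × X)} (hL : L ∈ 𝓔) :
    ∃ F ∈ 𝓔, ∀ α, ∀ z ∈ cone L x₀ (A α), ∀ z' ∈ cone L x₀ (A α), ∀ m : ℕ,
      z.1.take m = z'.1.take m →
        Dstar F x₀ z z' ≤ ((z.1.length - m) + (z'.1.length - m) : ℕ) := by
  obtain ⟨Kb, ⟨E, hE, n, hKb⟩, hA⟩ := hbdd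
  have hdiag := h𝓔.1
  set Δ : Set (X × X) := {p | p.1 = p.2} with hΔ
  set S : Set (X × X) := (L ∪ Prod.swap '' L) ∪ Δ with hS
  set G : Set (X × X) := {p | DE E p.1 p.2 ≤ n} ∪ Δ with hG
  have hS_mem : S ∈ 𝓔 := h𝓔.2.2.1 _ (h𝓔.2.2.1 _ hL _ (h𝓔.2.1 _ hL)) _ hdiag
  have hG_mem : G ∈ 𝓔 := h𝓔.2.2.1 _ (h𝓔.DE_le_mem hE n) _ hdiag
  have hSrefl : ∀ a, (a, a) ∈ S := fun a => Or.inr rfl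
  have hGrefl : ∀ a, (a, a) ∈ G := fun a => Or.inr rfl
  have hball : ∀ c ∈ symmBall L x₀, (c, x₀) ∈ S ∧ (x₀, c) ∈ S := by
    rintro c (hc | hc)
    · exact ⟨Or.inl (Or.inr ⟨_, hc, rfl⟩), Or.inl (Or.inl hc)⟩
    · exact ⟨Or.inl (Or.inl hc), Or.inl (Or.inr ⟨_, hc, rfl⟩)⟩
  refine ⟨rcomp S (rcomp G S), h𝓔.2.2.2.2 _ hS_mem _ (h𝓔.2.2.2.2 _ hG_mem _ hS_mem), ?_⟩
  intro α z hz z' hz' m hm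
  obtain ⟨x, hx⟩ := hflat α
  obtain ⟨l, hl, hlt, b, hb, hlb⟩ := exists_suffix_of_mem_cone hx hz
  obtain ⟨l', hl', hlt', b', hb', hlb'⟩ := exists_suffix_of_mem_cone hx hz'
  have hbb' : (b, b') ∈ G :=
    (DE_le_of_Dstar_ofLetter (hKb (hA α _ hb _ hb'))).elim Or.inr Or.inl
  have near : ∀ {c d : X}, (c = d ∨ d = x₀ ∧ c ∈ symmBall L x₀) → (c, d) ∈ S ∧ (d, c) ∈ S := by
    rintro c d (rfl | ⟨rfl, hc⟩)
    · exact ⟨hSrefl _, hSrefl _⟩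
    · exact hball c hc
  have hmem : ∀ a ∈ insert x₀ (symmBall L x₀), (a, x₀) ∈ S ∧ (x₀, a) ∈ S := by
    rintro a (rfl | ha)
    · exact ⟨hSrefl _, hSrefl _⟩
    · exact hball a ha
  have key := DstarList_le_length_sub (E := rcomp S (rcomp G S))
    (C := insert x₀ (symmBall L x₀))
    (fun a ha c hc => ⟨x₀, (hmem a ha).1, x₀, hGrefl x₀, (hmem c hc).2⟩)
    (mem_insert _ _) (m - x.1.length) l l' (fun c hc => mem_insert_of_mem _ (hlt c hc))
    (fun c hc => mem_insert_of_mem _ (hlt' c hc))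
    ⟨b, (near hlb).1, b', hbb', (near hlb').2⟩
    (by rw [hl, hl', List.take_append, List.take_append] at hm
        exact List.append_cancel_left hm)
  rw [Dstar, hl, hl', DstarList_append]
  refine key.trans ?_
  norm_cast
  simp only [List.length_append]
  omega

/-- If `{A_α}` is a uniformly bounded collection of flat subsets of `∗X`, then for each
entourage `L ∈ 𝓔` the collection of cones `{con_L(A_α)}` has asymptotic dimension at
most `1` uniformly. -/
theorem cones_over_flats_asdim_le_one
    {X : Type u} (𝓔 : Set (Set (X × X))) (h𝓔 : IsCoarseStructure 𝓔) (x₀ : X)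
    {J : Type v} (A : J → Set (FreeWord X x₀))
    (hflat : ∀ α : J, IsFlat (A α))
    (hbdd : ∃ Kb ∈ freeEnts 𝓔 x₀, ∀ α : J, ∀ u ∈ A α, ∀ v ∈ A α, (u, v) ∈ Kb)
    (L : Set (X × X)) (hL : L ∈ 𝓔) :
    UniformAsdimLE (freeEnts 𝓔 x₀) (fun α : J => cone L x₀ (A α)) 1 := by
  obtain ⟨F, hF, hcone⟩ := exists_entourage_cone_Dstar_le h𝓔 hflat hbdd hL
  rintro T ⟨E', ⟨E, -, R, hE'⟩, hT⟩
  refine ⟨{p | p.1.1 = p.2.1 ∧ ((p.1.2 : FreeWord X x₀), (p.2.2 : FreeWord X x₀)) ∈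
      bracket F x₀ (4 * (R + 1))},
    ⟨_, ⟨F, hF, 4 * (R + 1), subset_rfl⟩, fun p hp => hp⟩,
    fun i => {V | ∃ (α : J) (k : ℕ) (w : List X), k % 2 = i ∧
      V = {y | y.1 = α ∧ (y.2 : FreeWord X x₀).1.length / (R + 1) = k ∧
        (y.2 : FreeWord X x₀).1.take ((k - 1) * (R + 1)) = w}}, ?_, ?_, ?_⟩
  · intro y
    exact ⟨⟨_, Nat.mod_lt _ two_pos⟩, _, ⟨y.1, _, _, rfl, rfl⟩, rfl, rfl, rfl⟩
  · rintro i _ ⟨α, k, w, hk, rfl⟩ _ ⟨α', k', w', hk', rfl⟩ hne u ⟨hu, huk, huw⟩ v ⟨hv, hvk, hvw⟩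
      huv
    apply hne
    obtain ⟨hα, huv⟩ := hT _ huv
    obtain ⟨h1, h2, h3⟩ := length_and_take_of_DstarList_le _ _ (u.2 : FreeWord X x₀).2
      (v.2 : FreeWord X x₀).2 (hE' huv)
    rw [Nat.div_eq_iff (by omega)] at huk hvk
    have hkk : k = k' := by
      rcases lt_trichotomy k k' with hlt | heq | hlt
      · have : k + 2 ≤ k' := by omega
        have := Nat.mul_le_mul_right (R + 1) this
        rw [add_mul] at this
        omega
      · exact heq
      · have : k' + 2 ≤ k := by omega
        have := Nat.mul_le_mul_right (R + 1) this
        rw [add_mul] at this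
        omega
    subst hkk
    have hle : (k - 1) * (R + 1) ≤ (u.2 : FreeWord X x₀).1.length - R := by
      rw [Nat.sub_mul]
      omega
    have hww : w = w' := by
      rw [← huw, ← hvw, ← min_eq_left hle, ← List.take_take, h3, List.take_take]
    rw [← hu, ← hv, hα, hww]
  · rintro i _ ⟨α, k, w, -, rfl⟩ ⟨β, u⟩ ⟨hu, huk, huw⟩ ⟨γ, v⟩ ⟨hv, hvk, hvw⟩
    obtain rfl : β = α := hu
    obtain rfl : γ = β := hv
    refine ⟨rfl, (hcone _ _ u.2 _ v.2 _ (huw.trans hvw.symm)).trans ?_⟩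
    dsimp only at huk hvk
    rw [Nat.div_eq_iff (by omega)] at huk hvk
    norm_cast
    rw [Nat.sub_mul]
    omega
end
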